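/- (Uniqueness of the non-blocking invariant point, second statement of Lemma 8.) Under Assumption A, if x ∈ X^□ satisfies x_{0^s} > 0 for all s ∈ 𝓢 and F^□(x) = 0 (so that x is an equilibrium point of the GRAND-F fluid dynamics), then x = x^{*,□}. -/

import Mathlib

open scoped BigOperators
open Filter Topology

noncomputable section

variable {I S : Type} [Fintype I] [DecidableEq I] [Fintype S]

/-- The configuration `e_i` consisting of a single type-`i` customer. -/
def econf (i : I) : I → ℕ := Pi.single i 1

/-- `K^s`: the set of nonzero configurations of server type `s`. -/
def Kc (Kbar : S → Finset (I → ℕ)) (s : S) : Finset (I → ℕ) := (Kbar s).erase 0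

/-- Monotonicity of the configuration sets. -/
def KbarMono (Kbar : S → Finset (I → ℕ)) : Prop :=
  ∀ s, ∀ k ∈ Kbar s, ∀ k' : I → ℕ, (∀ i, k' i ≤ k i) → k' ∈ Kbar s

/-- Each configuration set contains the zero configuration. -/
def KbarZero (Kbar : S → Finset (I → ℕ)) : Prop := ∀ s, (0 : I → ℕ) ∈ Kbar s

/-- Every customer type can be served by some server type. -/
def KbarServe (Kbar : S → Finset (I → ℕ)) : Prop := ∀ i : I, ∃ s, econf i ∈ Kbar s

/-- `ℝ_+^K`: nonnegative vectors supported on the nonzero configurations. -/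
def orthK (Kbar : S → Finset (I → ℕ)) : Set (S → (I → ℕ) → ℝ) :=
  {x | (∀ s k, 0 ≤ x s k) ∧ ∀ s, ∀ k, k ∉ Kc Kbar s → x s k = 0}

/-- The feasible set `X` (equality constraints). -/
def feasX (Kbar : S → Finset (I → ℕ)) (ρ : I → ℝ) : Set (S → (I → ℕ) → ℝ) :=
  {x | x ∈ orthK Kbar ∧ ∀ i, ∑ s, ∑ k ∈ Kc Kbar s, (k i : ℝ) * x s k = ρ i}

/-- The relaxed feasible set (inequality constraints). -/
def feasXge (Kbar : S → Finset (I → ℕ)) (ρ : I → ℝ) : Set (S → (I → ℕ) → ℝ) :=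
  {x | x ∈ orthK Kbar ∧ ∀ i, ρ i ≤ ∑ s, ∑ k ∈ Kc Kbar s, (k i : ℝ) * x s k}

/-- The weighted number of occupied servers. -/
def objW (Kbar : S → Finset (I → ℕ)) (γ : S → ℝ) (x : S → (I → ℕ) → ℝ) : ℝ :=
  ∑ s, ∑ k ∈ Kc Kbar s, γ s * x s k

/-- `X*`: optimal solutions of LP=. -/
def XstarSet (Kbar : S → Finset (I → ℕ)) (ρ : I → ℝ) (γ : S → ℝ) :
    Set (S → (I → ℕ) → ℝ) :=
  {x | x ∈ feasX Kbar ρ ∧ ∀ y ∈ feasX Kbar ρ, objW Kbar γ x ≤ objW Kbar γ y}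

/-- `X**`: optimal solutions of LP≤. -/
def XstarSetGe (Kbar : S → Finset (I → ℕ)) (ρ : I → ℝ) (γ : S → ℝ) :
    Set (S → (I → ℕ) → ℝ) :=
  {x | x ∈ feasXge Kbar ρ ∧ ∀ y ∈ feasXge Kbar ρ, objW Kbar γ x ≤ objW Kbar γ y}

/-- `H*`: dual optimal vectors. -/
def HstarSet (Kbar : S → Finset (I → ℕ)) (ρ : I → ℝ) (γ : S → ℝ) : Set (I → ℝ) :=
  {η | ∃ x ∈ feasX Kbar ρ, (∀ i, 0 ≤ η i) ∧
    (∀ s, ∀ k ∈ Kc Kbar s, ∑ i, (k i : ℝ) * η i ≤ γ s) ∧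
    (∀ s, ∀ k ∈ Kc Kbar s, (∑ i, (k i : ℝ) * η i) < γ s → x s k = 0)}

/-- `c_k = ∏_i k_i!`. -/
def ck (k : I → ℕ) : ℝ := ∏ i, (Nat.factorial (k i) : ℝ)

/-- The function `L^{(a)}`. -/
def Lfun (Kbar : S → Finset (I → ℕ)) (a : S → ℝ) (x : S → (I → ℕ) → ℝ) : ℝ :=
  ∑ s, ∑ k ∈ Kc Kbar s, x s k * Real.log (x s k * ck k / (Real.exp 1 * a s))

/-- Product form (infinite-server system). -/
def prodForm (Kbar : S → Finset (I → ℕ)) (a : S → ℝ) (x : S → (I → ℕ) → ℝ)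
    (ν : I → ℝ) : Prop :=
  ∀ s, ∀ k ∈ Kc Kbar s, x s k = a s / ck k * Real.exp (∑ i, (k i : ℝ) * ν i)

/-- ℓ¹ distance on the coordinates indexed by `K`. -/
def distK (Kbar : S → Finset (I → ℕ)) (x y : S → (I → ℕ) → ℝ) : ℝ :=
  ∑ s, ∑ k ∈ Kc Kbar s, |x s k - y s k|

/-- Extended coordinate value: the zero configuration of type `s` has value `a_s`. -/
def xval (a : S → ℝ) (x : S → (I → ℕ) → ℝ) (s : S) (k : I → ℕ) : ℝ :=
  if k = 0 then a s else x s k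

/-- `x_{(i)}`: amount of servers available to a type-`i` arrival (GRAND(aZ)). -/
def xavail (Kbar : S → Finset (I → ℕ)) (a : S → ℝ) (x : S → (I → ℕ) → ℝ) (i : I) : ℝ :=
  ∑ s, ((if econf i ∈ Kc Kbar s then a s else 0)
    + ∑ k ∈ (Kc Kbar s).filter (fun k => k + econf i ∈ Kbar s), x s k)

/-- Departure rate `w_{k i}`. -/
def wrate (μ : I → ℝ) (x : S → (I → ℕ) → ℝ) (s : S) (k : I → ℕ) (i : I) : ℝ :=
  (k i : ℝ) * μ i * x s k

/-- Arrival rate `v_{k i}` (GRAND(aZ)), with `λ_i = μ_i ρ_i`. -/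
def vrate (Kbar : S → Finset (I → ℕ)) (a : S → ℝ) (μ ρ : I → ℝ)
    (x : S → (I → ℕ) → ℝ) (s : S) (k : I → ℕ) (i : I) : ℝ :=
  μ i * ρ i * xval a x s (k - econf i) / xavail Kbar a x i

/-- The GRAND(aZ) fluid vector field `F_k(x)`, for `k ∈ K^s`. -/
def Fdrift (Kbar : S → Finset (I → ℕ)) (a : S → ℝ) (μ ρ : I → ℝ)
    (x : S → (I → ℕ) → ℝ) (s : S) (k : I → ℕ) : ℝ :=
  (∑ i ∈ Finset.univ.filter (fun i : I => 1 ≤ k i ∧ k - econf i ∈ Kbar s),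
    (vrate Kbar a μ ρ x s k i - wrate μ x s k i))
  - ∑ i ∈ Finset.univ.filter (fun i : I => k + econf i ∈ Kbar s),
    (vrate Kbar a μ ρ x s (k + econf i) i - wrate μ x s (k + econf i) i)

/-- The function `Ξ(x)` (GRAND(aZ)). -/
def Xi (Kbar : S → Finset (I → ℕ)) (a : S → ℝ) (μ : I → ℝ)
    (x : S → (I → ℕ) → ℝ) : ℝ :=
  ∑ i : I, ∑ s : S,
    ∑ k ∈ (Kc Kbar s).filter (fun k => 1 ≤ k i ∧ k - econf i ∈ Kbar s),
      ∑ s' : S,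
        ∑ k' ∈ (Kc Kbar s').filter (fun k' => 1 ≤ k' i ∧ k' - econf i ∈ Kbar s'),
          (Real.log ((k' i : ℝ) * xval a x s (k - econf i) * x s' k')
            - Real.log ((k i : ℝ) * x s k * xval a x s' (k' - econf i)))
          * ((k i : ℝ) * μ i * x s k * xval a x s' (k' - econf i) / xavail Kbar a x i)

open Classical in
/-- `Ξ` extended by `−∞` to points with a vanishing coordinate, as a map into `[−∞, 0] ⊆ EReal`. -/
def XiE (Kbar : S → Finset (I → ℕ)) (a : S → ℝ) (μ : I → ℝ)
    (x : S → (I → ℕ) → ℝ) : EReal :=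
  if ∀ s, ∀ k ∈ Kc Kbar s, 0 < x s k then ((Xi Kbar a μ x : ℝ) : EReal) else ⊥

/-! Finite-server (GRAND-F) objects. -/

/-- `X^□`. -/
def XBox (Kbar : S → Finset (I → ℕ)) (h : S → ℝ) : Set (S → (I → ℕ) → ℝ) :=
  {x | x ∈ orthK Kbar ∧ ∀ s, ∑ k ∈ Kc Kbar s, x s k ≤ h s}

/-- `x_{0^s} = h_s − Σ_{k∈K^s} x_k`. -/
def x0 (Kbar : S → Finset (I → ℕ)) (h : S → ℝ) (x : S → (I → ℕ) → ℝ) (s : S) : ℝ :=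
  h s - ∑ k ∈ Kc Kbar s, x s k

/-- `X^⋄ = X^□ ∩ X`. -/
def XDiamond (Kbar : S → Finset (I → ℕ)) (h : S → ℝ) (ρ : I → ℝ) :
    Set (S → (I → ℕ) → ℝ) := XBox Kbar h ∩ feasX Kbar ρ

/-- Assumption A: a feasible point with idle servers of every type. -/
def AssumptionA (Kbar : S → Finset (I → ℕ)) (h : S → ℝ) (ρ : I → ℝ) : Prop :=
  ∃ x ∈ XDiamond Kbar h ρ, ∀ s, 0 < x0 Kbar h x s

/-- The function `L^□`. -/
def LBox (Kbar : S → Finset (I → ℕ)) (h : S → ℝ) (x : S → (I → ℕ) → ℝ) : ℝ :=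
  ∑ s, (x0 Kbar h x s * Real.log (x0 Kbar h x s / Real.exp 1)
    + ∑ k ∈ Kc Kbar s, x s k * Real.log (x s k * ck k / Real.exp 1))

/-- Product form (finite-server system), including the zero configurations. -/
def prodFormBox (Kbar : S → Finset (I → ℕ)) (h : S → ℝ) (x : S → (I → ℕ) → ℝ)
    (ν : I → ℝ) (β : S → ℝ) : Prop :=
  ∀ s, x0 Kbar h x s = Real.exp (-β s) ∧
    ∀ k ∈ Kc Kbar s, x s k = Real.exp (-β s) / ck k * Real.exp (∑ i, (k i : ℝ) * ν i)

/-- Extended coordinate value for the finite-server system. -/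
def xvalBox (Kbar : S → Finset (I → ℕ)) (h : S → ℝ) (x : S → (I → ℕ) → ℝ)
    (s : S) (k : I → ℕ) : ℝ :=
  if k = 0 then x0 Kbar h x s else x s k

/-- `x_{(i)}` for the finite-server system (zero configurations included). -/
def xavailBox (Kbar : S → Finset (I → ℕ)) (h : S → ℝ) (x : S → (I → ℕ) → ℝ)
    (i : I) : ℝ :=
  ∑ s, ((if econf i ∈ Kc Kbar s then x0 Kbar h x s else 0)
    + ∑ k ∈ (Kc Kbar s).filter (fun k => k + econf i ∈ Kbar s), x s k)

/-- Arrival rate `v_{k i}` (GRAND-F), with `λ_i = μ_i ρ_i`. -/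
def vrateBox (Kbar : S → Finset (I → ℕ)) (h : S → ℝ) (μ ρ : I → ℝ)
    (x : S → (I → ℕ) → ℝ) (s : S) (k : I → ℕ) (i : I) : ℝ :=
  μ i * ρ i * xvalBox Kbar h x s (k - econf i) / xavailBox Kbar h x i

/-- The GRAND-F fluid vector field `F^□_k(x)`, for `k ∈ K^s`. -/
def FdriftBox (Kbar : S → Finset (I → ℕ)) (h : S → ℝ) (μ ρ : I → ℝ)
    (x : S → (I → ℕ) → ℝ) (s : S) (k : I → ℕ) : ℝ :=
  (∑ i ∈ Finset.univ.filter (fun i : I => 1 ≤ k i ∧ k - econf i ∈ Kbar s),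
    (vrateBox Kbar h μ ρ x s k i - wrate μ x s k i))
  - ∑ i ∈ Finset.univ.filter (fun i : I => k + econf i ∈ Kbar s),
    (vrateBox Kbar h μ ρ x s (k + econf i) i - wrate μ x s (k + econf i) i)

/-- The function `Ξ^□(x̄)`. -/
def XiBox (Kbar : S → Finset (I → ℕ)) (h : S → ℝ) (μ : I → ℝ)
    (x : S → (I → ℕ) → ℝ) : ℝ :=
  ∑ i : I, ∑ s : S,
    ∑ k ∈ (Kc Kbar s).filter (fun k => 1 ≤ k i ∧ k - econf i ∈ Kbar s),
      ∑ s' : S,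
        ∑ k' ∈ (Kc Kbar s').filter (fun k' => 1 ≤ k' i ∧ k' - econf i ∈ Kbar s'),
          (Real.log ((k' i : ℝ) * xvalBox Kbar h x s (k - econf i) * x s' k')
            - Real.log ((k i : ℝ) * x s k * xvalBox Kbar h x s' (k' - econf i)))
          * ((k i : ℝ) * μ i * x s k * xvalBox Kbar h x s' (k' - econf i)
              / xavailBox Kbar h x i)

lemma add_econf_ne_zero (k : I → ℕ) (i : I) : k + econf i ≠ 0 := by
  intro h
  simpa [econf] using congrFun h i

lemma sub_econf_add_econf {k : I → ℕ} {i : I} (hk : 1 ≤ k i) :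
    k - econf i + econf i = k := by
  funext j
  by_cases hj : j = i
  · subst hj
    simp [econf, hk]
  · simp [econf, hj]

lemma econf_add_sub_econf (k : I → ℕ) (i : I) : k + econf i - econf i = k := by
  funext j
  simp

lemma ck_pos (k : I → ℕ) : 0 < ck k :=
  Finset.prod_pos fun i _ => by exact_mod_cast Nat.factorial_pos (k i)

lemma ck_zero : ck (0 : I → ℕ) = 1 := by simp [ck]

lemma ck_add_econf (k : I → ℕ) (i : I) : ck (k + econf i) = (k i + 1) * ck k := by
  have h : ∀ j, (((k + econf i) j).factorial : ℝ)
      = (if j = i then (k j + 1 : ℝ) else 1) * ((k j).factorial : ℝ) := by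
    intro j
    by_cases hj : j = i
    · subst hj
      simp [econf, Nat.factorial_succ]
    · simp [econf, hj]
  simp only [ck, h, Finset.prod_mul_distrib, Finset.prod_ite_eq', Finset.mem_univ, if_true]

/-- Reindexing a sum over configurations holding a type-`i` customer by removing that customer. -/
lemma sum_filter_one_le_eq (B : Finset (I → ℕ)) (i : I) (f : (I → ℕ) → ℝ) :
    ∑ k ∈ B with 1 ≤ k i ∧ k - econf i ∈ B, f k
      = ∑ k ∈ B with k + econf i ∈ B, f (k + econf i) := by
  refine Finset.sum_nbij' (fun k => k - econf i) (fun k => k + econf i) ?_ ?_ ?_ ?_ ?_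
  · intro k hk
    simp only [Finset.mem_filter] at hk ⊢
    exact ⟨hk.2.2, by rw [sub_econf_add_econf hk.2.1]; exact hk.1⟩
  · intro k hk
    simp only [Finset.mem_filter] at hk ⊢
    refine ⟨hk.2, by simp [econf], by rw [econf_add_sub_econf]; exact hk.1⟩
  · intro k hk
    simp only [Finset.mem_filter] at hk
    exact sub_econf_add_econf hk.2.1
  · intro k _
    exact econf_add_sub_econf k i
  · intro k hk
    simp only [Finset.mem_filter] at hk
    rw [sub_econf_add_econf hk.2.1]

/-- Summation by parts for a flux `D` between neighbouring configurations. -/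
lemma sum_mul_flux_eq (B : Finset (I → ℕ)) (g : (I → ℕ) → ℝ) (D : (I → ℕ) → I → ℝ) :
    ∑ k ∈ B, g k * ((∑ i with 1 ≤ k i ∧ k - econf i ∈ B, D k i)
        - ∑ i with k + econf i ∈ B, D (k + econf i) i)
      = ∑ i, ∑ k ∈ B with k + econf i ∈ B, D (k + econf i) i * (g (k + econf i) - g k) := by
  have h1 : ∑ k ∈ B, g k * ∑ i with 1 ≤ k i ∧ k - econf i ∈ B, D k i
      = ∑ i, ∑ k ∈ B with k + econf i ∈ B, g (k + econf i) * D (k + econf i) i := by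
    simp_rw [← fun i => sum_filter_one_le_eq B i (fun k => g k * D k i), Finset.mul_sum,
      Finset.sum_filter]
    exact Finset.sum_comm
  have h2 : ∑ k ∈ B, g k * ∑ i with k + econf i ∈ B, D (k + econf i) i
      = ∑ i, ∑ k ∈ B with k + econf i ∈ B, g k * D (k + econf i) i := by
    simp_rw [Finset.mul_sum, Finset.sum_filter]
    exact Finset.sum_comm
  simp_rw [mul_sub, Finset.sum_sub_distrib, h1, h2, mul_comm]

lemma sub_mul_log_div_nonneg {a b : ℝ} (ha : 0 < a) (hb : 0 < b) :
    0 ≤ (a - b) * (Real.log a - Real.log b) := by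
  rcases le_total a b with h | h
  · exact mul_nonneg_of_nonpos_of_nonpos (by linarith)
      (by linarith [Real.log_le_log ha h])
  · exact mul_nonneg (by linarith) (by linarith [Real.log_le_log hb h])

lemma eq_of_sub_mul_log_sub_eq_zero {a b : ℝ} (ha : 0 < a) (hb : 0 < b)
    (h : (a - b) * (Real.log a - Real.log b) = 0) : a = b := by
  rcases mul_eq_zero.1 h with h | h
  · linarith
  · exact Real.log_injOn_pos ha hb (by linarith)

/-- The gap between `t ↦ t log (t c / e)` and its tangent at `u`. -/
lemma entropy_gap_nonneg {t u c : ℝ} (ht : 0 ≤ t) (hu : 0 < u) (hc : 0 < c) :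
    0 ≤ t * Real.log (t * c / Real.exp 1) - u * Real.log (u * c / Real.exp 1)
      - (t - u) * Real.log (u * c) ∧
    (t * Real.log (t * c / Real.exp 1) - u * Real.log (u * c / Real.exp 1)
      - (t - u) * Real.log (u * c) = 0 → t = u) := by
  have hue : Real.log (u * c / Real.exp 1) = Real.log (u * c) - 1 := by
    rw [Real.log_div (by positivity) (by positivity), Real.log_exp]
  rcases ht.eq_or_lt with rfl | ht
  · rw [hue]
    constructor
    · nlinarith
    · intro h
      nlinarith
  have hte : Real.log (t * c / Real.exp 1) = Real.log (t * c) - 1 := by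
    rw [Real.log_div (by positivity) (by positivity), Real.log_exp]
  rw [hue, hte, Real.log_mul hu.ne' hc.ne', Real.log_mul ht.ne' hc.ne']
  have hlog : Real.log (u / t) = Real.log u - Real.log t := Real.log_div hu.ne' ht.ne'
  have hmul : t * (u / t) = u := by field_simp
  have hle := Real.log_le_sub_one_of_pos (div_pos hu ht)
  constructor
  · nlinarith
  · intro h
    by_contra hne
    have hlt := Real.log_lt_sub_one_of_pos (div_pos hu ht)
      (fun h1 => hne (by rw [h1] at hmul; linarith))
    nlinarith

section BoxValues

variable {Kbar : S → Finset (I → ℕ)} {h : S → ℝ} {x : S → (I → ℕ) → ℝ}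


lemma xvalBox_zero (s : S) : xvalBox Kbar h x s 0 = x0 Kbar h x s := by simp [xvalBox]

lemma xvalBox_of_ne_zero (s : S) {k : I → ℕ} (hk : k ≠ 0) : xvalBox Kbar h x s k = x s k := by
  simp [xvalBox, hk]

lemma sum_Kbar_eq (hzero : KbarZero Kbar) (s : S) (f : (I → ℕ) → ℝ) :
    ∑ k ∈ Kbar s, f k = f 0 + ∑ k ∈ Kc Kbar s, f k :=
  (Finset.add_sum_erase _ f (hzero s)).symm

lemma sum_Kc_mul_xvalBox (s : S) (f : (I → ℕ) → ℝ) :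
    ∑ k ∈ Kc Kbar s, f k * xvalBox Kbar h x s k = ∑ k ∈ Kc Kbar s, f k * x s k :=
  Finset.sum_congr rfl fun k hk => by rw [xvalBox_of_ne_zero s (Finset.ne_of_mem_erase hk)]

lemma sum_xvalBox (hzero : KbarZero Kbar) (s : S) : ∑ k ∈ Kbar s, xvalBox Kbar h x s k = h s := by
  have hsum := sum_Kc_mul_xvalBox (Kbar := Kbar) (h := h) (x := x) s 1
  simp only [Pi.one_apply, one_mul] at hsum
  rw [sum_Kbar_eq hzero, xvalBox_zero, hsum, x0]
  ring

lemma xavailBox_eq (hzero : KbarZero Kbar) (i : I) :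
    xavailBox Kbar h x i
      = ∑ s, ∑ k ∈ Kbar s with k + econf i ∈ Kbar s, xvalBox Kbar h x s k := by
  refine Finset.sum_congr rfl fun s _ => ?_
  rw [Finset.sum_filter, Finset.sum_filter, sum_Kbar_eq hzero]
  congr 1
  · have : econf i ≠ 0 := by simpa using add_econf_ne_zero 0 i
    simp [Kc, xvalBox_zero, this]
  · refine Finset.sum_congr rfl fun k hk => ?_
    rw [xvalBox_of_ne_zero s (Finset.ne_of_mem_erase hk)]

lemma sum_type_eq (hmono : KbarMono Kbar) (hzero : KbarZero Kbar) (s : S) (i : I) :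
    ∑ k ∈ Kc Kbar s, (k i : ℝ) * x s k
      = ∑ k ∈ Kbar s with k + econf i ∈ Kbar s,
        ((k i : ℝ) + 1) * xvalBox Kbar h x s (k + econf i) := by
  have h1 := sum_filter_one_le_eq (Kbar s) i (fun k => (k i : ℝ) * xvalBox Kbar h x s k)
  have h2 : ∑ k ∈ Kbar s with 1 ≤ k i ∧ k - econf i ∈ Kbar s, (k i : ℝ) * xvalBox Kbar h x s k
      = ∑ k ∈ Kbar s, (k i : ℝ) * xvalBox Kbar h x s k := by
    refine Finset.sum_filter_of_ne fun k hk hne => ⟨?_, ?_⟩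
    · by_contra hlt
      exact hne (by simp [show k i = 0 by omega])
    · exact hmono s k hk _ fun j => by simp
  rw [h2, sum_Kbar_eq hzero] at h1
  simp only [Pi.zero_apply, Nat.cast_zero, zero_mul, zero_add] at h1
  rw [← sum_Kc_mul_xvalBox (h := h), h1]
  refine Finset.sum_congr rfl fun k _ => ?_
  simp [econf]

lemma xvalBox_nonneg (hx : x ∈ XBox Kbar h) (s : S) (k : I → ℕ) : 0 ≤ xvalBox Kbar h x s k := by
  unfold xvalBox
  split_ifs
  · exact sub_nonneg.2 (hx.2 s)
  · exact hx.1.1 s k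

lemma xavailBox_pos (hzero : KbarZero Kbar) (hserve : KbarServe Kbar) (hx : x ∈ XBox Kbar h)
    (hpos0 : ∀ s, 0 < x0 Kbar h x s) (i : I) : 0 < xavailBox Kbar h x i := by
  obtain ⟨s, hs⟩ := hserve i
  rw [xavailBox_eq hzero]
  refine Finset.sum_pos' (fun s _ => Finset.sum_nonneg fun k _ => xvalBox_nonneg hx s k)
    ⟨s, Finset.mem_univ s, Finset.sum_pos' (fun k _ => xvalBox_nonneg hx s k) ⟨0, ?_, ?_⟩⟩
  · simpa [hzero s] using hs
  · rw [xvalBox_zero]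
    exact hpos0 s

variable {μ ρ : I → ℝ}

/-- At an equilibrium with idle servers every configuration has positive mass. -/
lemma xvalBox_pos (hmono : KbarMono Kbar) (hzero : KbarZero Kbar) (hserve : KbarServe Kbar)
    (hρpos : ∀ i, 0 < ρ i) (hμpos : ∀ i, 0 < μ i) (hx : x ∈ XBox Kbar h)
    (hpos0 : ∀ s, 0 < x0 Kbar h x s)
    (heq : ∀ s, ∀ k ∈ Kc Kbar s, FdriftBox Kbar h μ ρ x s k = 0) (s : S) (k : I → ℕ)
    (hk : k ∈ Kbar s) : 0 < xvalBox Kbar h x s k := by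
  induction hn : ∑ i, k i using Nat.strong_induction_on generalizing k with
  | _ n ih =>
  by_cases hk0 : k = 0
  · subst hk0
    rw [xvalBox_zero]
    exact hpos0 s
  obtain ⟨i, hi⟩ : ∃ i, k i ≠ 0 := by
    by_contra! hall
    exact hk0 (funext hall)
  have hi1 : 1 ≤ k i := Nat.one_le_iff_ne_zero.2 hi
  have hmem : k - econf i ∈ Kbar s := hmono s k hk _ fun j => by simp
  have hprev : 0 < xvalBox Kbar h x s (k - econf i) := by
    refine ih _ ?_ _ hmem rfl
    rw [← hn]
    refine Finset.sum_lt_sum (fun j _ => by simp) ⟨i, Finset.mem_univ i, ?_⟩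
    simp only [econf, Pi.sub_apply, Pi.single_eq_same]
    omega
  refine (xvalBox_nonneg hx s k).lt_of_ne' fun hzero_k => ?_
  have hxk : x s k = 0 := by rwa [xvalBox_of_ne_zero s hk0] at hzero_k
  have hF := heq s k (Finset.mem_erase.2 ⟨hk0, hk⟩)
  have hav := xavailBox_pos hzero hserve hx hpos0
  have hv : ∀ k' j, 0 ≤ vrateBox Kbar h μ ρ x s k' j := fun k' j =>
    div_nonneg (mul_nonneg (mul_nonneg (hμpos j).le (hρpos j).le) (xvalBox_nonneg hx s _))
      (hav j).le
  have hin : 0 < ∑ j with 1 ≤ k j ∧ k - econf j ∈ Kbar s,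
      (vrateBox Kbar h μ ρ x s k j - wrate μ x s k j) := by
    refine Finset.sum_pos' (fun j _ => by simp [wrate, hxk, hv]) ⟨i, by simp [hmem, hi1], ?_⟩
    simp only [wrate, hxk, mul_zero, sub_zero]
    exact div_pos (mul_pos (mul_pos (hμpos i) (hρpos i)) hprev) (hav i)
  have hout : ∑ j with k + econf j ∈ Kbar s,
      (vrateBox Kbar h μ ρ x s (k + econf j) j - wrate μ x s (k + econf j) j) ≤ 0 := by
    refine Finset.sum_nonpos fun j _ => ?_
    have : 0 ≤ wrate μ x s (k + econf j) j :=
      mul_nonneg (mul_nonneg (Nat.cast_nonneg _) (hμpos j).le) (hx.1.1 s _)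
    simpa [vrateBox, econf_add_sub_econf, hzero_k] using this
  unfold FdriftBox at hF
  linarith

/-- Net rate of the transition adding a type-`i` customer to configuration `k`. -/
lemma vrateBox_sub_wrate (s : S) (k : I → ℕ) (i : I) :
    vrateBox Kbar h μ ρ x s (k + econf i) i - wrate μ x s (k + econf i) i
      = μ i * (ρ i / xavailBox Kbar h x i * xvalBox Kbar h x s k
        - ((k i : ℝ) + 1) * xvalBox Kbar h x s (k + econf i)) := by
  rw [xvalBox_of_ne_zero s (add_econf_ne_zero k i), vrateBox, wrate, econf_add_sub_econf]
  simp only [econf, Pi.add_apply, Pi.single_eq_same, Nat.cast_add, Nat.cast_one]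
  ring

/-- At an equilibrium, the net rates are orthogonal to all discrete gradients. -/
lemma sum_rate_mul_sub_eq_zero (hzero : KbarZero Kbar)
    (heq : ∀ s, ∀ k ∈ Kc Kbar s, FdriftBox Kbar h μ ρ x s k = 0) (s : S) (g : (I → ℕ) → ℝ) :
    ∑ i, ∑ k ∈ Kbar s with k + econf i ∈ Kbar s,
      μ i * (ρ i / xavailBox Kbar h x i * xvalBox Kbar h x s k
        - ((k i : ℝ) + 1) * xvalBox Kbar h x s (k + econf i)) * (g (k + econf i) - g k) = 0 := by
  have hparts := sum_mul_flux_eq (Kbar s) (fun k => g k - g 0)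
    (fun k i => vrateBox Kbar h μ ρ x s k i - wrate μ x s k i)
  simp only [sub_sub_sub_cancel_right, vrateBox_sub_wrate] at hparts
  rw [← hparts, sum_Kbar_eq hzero, sub_self, zero_mul, zero_add]
  refine Finset.sum_eq_zero fun k hk => ?_
  have := heq s k hk
  simp only [FdriftBox, vrateBox_sub_wrate] at this
  rw [this, mul_zero]

/-- At an equilibrium the total net rate of type-`i` transitions vanishes. -/
lemma sum_rate_eq_zero (hzero : KbarZero Kbar) (hμpos : ∀ i, 0 < μ i)
    (heq : ∀ s, ∀ k ∈ Kc Kbar s, FdriftBox Kbar h μ ρ x s k = 0) (s : S) (i : I) :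
    ∑ k ∈ Kbar s with k + econf i ∈ Kbar s,
      (ρ i / xavailBox Kbar h x i * xvalBox Kbar h x s k
        - ((k i : ℝ) + 1) * xvalBox Kbar h x s (k + econf i)) = 0 := by
  have hsum := sum_rate_mul_sub_eq_zero hzero heq s (fun k => (k i : ℝ))
  rw [Finset.sum_eq_single i] at hsum
  · simp only [econf, Pi.add_apply, Pi.single_eq_same, Nat.cast_add, Nat.cast_one,
      add_sub_cancel_left, mul_one, ← Finset.mul_sum] at hsum
    exact (mul_eq_zero.1 hsum).resolve_left (hμpos i).ne'
  · intro j _ hj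
    exact Finset.sum_eq_zero fun k _ => by simp [econf, hj.symm]
  · simp

/-- Equilibria with idle servers carry the nominal load. -/
lemma sum_type_eq_load (hmono : KbarMono Kbar) (hzero : KbarZero Kbar) (hserve : KbarServe Kbar)
    (hμpos : ∀ i, 0 < μ i) (hx : x ∈ XBox Kbar h) (hpos0 : ∀ s, 0 < x0 Kbar h x s)
    (heq : ∀ s, ∀ k ∈ Kc Kbar s, FdriftBox Kbar h μ ρ x s k = 0) (i : I) :
    ∑ s, ∑ k ∈ Kc Kbar s, (k i : ℝ) * x s k = ρ i := by
  have hrate := Finset.sum_eq_zero fun s (_ : s ∈ Finset.univ) =>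
    sum_rate_eq_zero hzero hμpos heq s i
  simp only [Finset.sum_sub_distrib, ← Finset.mul_sum, ← xavailBox_eq hzero] at hrate
  rw [div_mul_cancel₀ _ (xavailBox_pos hzero hserve hx hpos0 i).ne'] at hrate
  simp only [sum_type_eq (h := h) hmono hzero]
  linarith

/-- Detailed balance at an equilibrium with idle servers. -/
lemma detailed_balance (hmono : KbarMono Kbar) (hzero : KbarZero Kbar) (hserve : KbarServe Kbar)
    (hρpos : ∀ i, 0 < ρ i) (hμpos : ∀ i, 0 < μ i) (hx : x ∈ XBox Kbar h)
    (hpos0 : ∀ s, 0 < x0 Kbar h x s)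
    (heq : ∀ s, ∀ k ∈ Kc Kbar s, FdriftBox Kbar h μ ρ x s k = 0) (s : S) (k : I → ℕ) (i : I)
    (hk : k ∈ Kbar s) (hki : k + econf i ∈ Kbar s) :
    ρ i / xavailBox Kbar h x i * xvalBox Kbar h x s k
      = ((k i : ℝ) + 1) * xvalBox Kbar h x s (k + econf i) := by
  set θ : I → ℝ := fun i => ρ i / xavailBox Kbar h x i with hθdef
  have hθ : ∀ i, 0 < θ i := fun i =>
    div_pos (hρpos i) (xavailBox_pos hzero hserve hx hpos0 i)
  have hp := xvalBox_pos hmono hzero hserve hρpos hμpos hx hpos0 heq s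
  set p := xvalBox Kbar h x s
  have hlog : ∀ i, ∀ k ∈ (Kbar s).filter (fun k => k + econf i ∈ Kbar s),
      μ i * ((θ i * p k - ((k i : ℝ) + 1) * p (k + econf i))
          * (Real.log (θ i * p k) - Real.log (((k i : ℝ) + 1) * p (k + econf i))))
        = μ i * Real.log (θ i) * (θ i * p k - ((k i : ℝ) + 1) * p (k + econf i))
          - μ i * (θ i * p k - ((k i : ℝ) + 1) * p (k + econf i))
            * (Real.log (ck (k + econf i) * p (k + econf i)) - Real.log (ck k * p k)) := by
    intro i k hk
    rw [Finset.mem_filter] at hk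
    have h1 := (hp k hk.1).ne'
    have h2 := (hp _ hk.2).ne'
    have h3 : ((k i : ℝ) + 1) ≠ 0 := by positivity
    have h4 := (ck_pos k).ne'
    rw [ck_add_econf, Real.log_mul (hθ i).ne' h1, Real.log_mul h3 h2,
      Real.log_mul (mul_ne_zero h3 h4) h2, Real.log_mul h3 h4, Real.log_mul h4 h1]
    ring
  have hnonneg : ∀ i, ∀ k ∈ (Kbar s).filter (fun k => k + econf i ∈ Kbar s),
      0 ≤ μ i * ((θ i * p k - ((k i : ℝ) + 1) * p (k + econf i))
          * (Real.log (θ i * p k) - Real.log (((k i : ℝ) + 1) * p (k + econf i)))) := by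
    intro i k hk
    rw [Finset.mem_filter] at hk
    have h1 := hp k hk.1
    have h2 := hp _ hk.2
    have := hθ i
    exact mul_nonneg (hμpos i).le (sub_mul_log_div_nonneg (by positivity) (by positivity))
  have hsum : ∑ i, ∑ k ∈ Kbar s with k + econf i ∈ Kbar s,
      μ i * ((θ i * p k - ((k i : ℝ) + 1) * p (k + econf i))
          * (Real.log (θ i * p k) - Real.log (((k i : ℝ) + 1) * p (k + econf i)))) = 0 := by
    have hflux : ∀ i, ∑ k ∈ Kbar s with k + econf i ∈ Kbar s,
        (θ i * p k - ((k i : ℝ) + 1) * p (k + econf i)) = 0 :=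
      sum_rate_eq_zero hzero hμpos heq s
    have hgrad := sum_rate_mul_sub_eq_zero hzero heq s (fun k => Real.log (ck k * p k))
    refine Eq.trans ?_ (neg_eq_zero.2 hgrad)
    rw [← Finset.sum_neg_distrib]
    refine Finset.sum_congr rfl fun i _ => ?_
    rw [Finset.sum_congr rfl (hlog i), Finset.sum_sub_distrib, ← Finset.mul_sum, hflux i,
      mul_zero, zero_sub]
  have hterm := (Finset.sum_eq_zero_iff_of_nonneg fun i _ => Finset.sum_nonneg (hnonneg i)).1 hsum
    i (Finset.mem_univ i)
  have hterm := (Finset.sum_eq_zero_iff_of_nonneg (hnonneg i)).1 hterm k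
    (Finset.mem_filter.2 ⟨hk, hki⟩)
  have h1 := hp k hk
  have h2 := hp _ hki
  have h3 := hθ i
  exact eq_of_sub_mul_log_sub_eq_zero (by positivity) (by positivity)
    ((mul_eq_zero.1 hterm).resolve_left (hμpos i).ne')

/-- Equilibria with idle servers have product form. -/
lemma log_ck_mul_xvalBox (hmono : KbarMono Kbar) (hzero : KbarZero Kbar)
    (hserve : KbarServe Kbar)
    (hρpos : ∀ i, 0 < ρ i) (hμpos : ∀ i, 0 < μ i) (hx : x ∈ XBox Kbar h)
    (hpos0 : ∀ s, 0 < x0 Kbar h x s)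
    (heq : ∀ s, ∀ k ∈ Kc Kbar s, FdriftBox Kbar h μ ρ x s k = 0) (s : S) (k : I → ℕ)
    (hk : k ∈ Kbar s) :
    Real.log (xvalBox Kbar h x s k * ck k)
      = Real.log (x0 Kbar h x s)
        + ∑ i, (k i : ℝ) * Real.log (ρ i / xavailBox Kbar h x i) := by
  induction hn : ∑ i, k i using Nat.strong_induction_on generalizing k with
  | _ n ih =>
  by_cases hk0 : k = 0
  · subst hk0
    simp [xvalBox_zero, ck_zero]
  obtain ⟨i, hi⟩ : ∃ i, k i ≠ 0 := by
    by_contra! hall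
    exact hk0 (funext hall)
  have hi1 : 1 ≤ k i := Nat.one_le_iff_ne_zero.2 hi
  obtain ⟨m, rfl⟩ : ∃ m, k = m + econf i := ⟨_, (sub_econf_add_econf hi1).symm⟩
  have hm : m ∈ Kbar s := hmono s _ hk _ fun j => by simp
  have hprev := ih _ (by
    rw [← hn]
    refine Finset.sum_lt_sum (fun j _ => by simp) ⟨i, Finset.mem_univ i, by simp [econf]⟩) m hm rfl
  have hbal := detailed_balance hmono hzero hserve hρpos hμpos hx hpos0 heq s m i hm hk
  have hpm := xvalBox_pos hmono hzero hserve hρpos hμpos hx hpos0 heq s m hm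
  have hθ := div_pos (hρpos i) (xavailBox_pos hzero hserve hx hpos0 i)
  have hval : xvalBox Kbar h x s (m + econf i) * ck (m + econf i)
      = ρ i / xavailBox Kbar h x i * (xvalBox Kbar h x s m * ck m) := by
    rw [ck_add_econf, ← mul_assoc (ρ i / xavailBox Kbar h x i), hbal]
    ring
  rw [hval, Real.log_mul hθ.ne' (mul_pos hpm (ck_pos m)).ne', hprev]
  have hexp : ∀ j, (((m + econf i) j : ℕ) : ℝ) * Real.log (ρ j / xavailBox Kbar h x j)
      = (m j : ℝ) * Real.log (ρ j / xavailBox Kbar h x j)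
        + if j = i then Real.log (ρ j / xavailBox Kbar h x j) else 0 := by
    intro j
    by_cases hj : j = i
    · subst hj
      simp [econf, add_mul]
    · simp [econf, hj]
  simp only [hexp, Finset.sum_add_distrib, Finset.sum_ite_eq', Finset.mem_univ, if_true]
  ring

lemma LBox_eq_sum (hzero : KbarZero Kbar) :
    LBox Kbar h x = ∑ s, ∑ k ∈ Kbar s,
      xvalBox Kbar h x s k * Real.log (xvalBox Kbar h x s k * ck k / Real.exp 1) := by
  refine Finset.sum_congr rfl fun s _ => ?_
  rw [sum_Kbar_eq hzero, xvalBox_zero, ck_zero, mul_one]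
  congr 1
  refine Finset.sum_congr rfl fun k hk => ?_
  rw [xvalBox_of_ne_zero s (Finset.ne_of_mem_erase hk)]

lemma sum_type_mul_xvalBox (hzero : KbarZero Kbar) (s : S) (i : I) :
    ∑ k ∈ Kbar s, (k i : ℝ) * xvalBox Kbar h x s k = ∑ k ∈ Kc Kbar s, (k i : ℝ) * x s k := by
  rw [sum_Kbar_eq hzero]
  simp only [Pi.zero_apply, Nat.cast_zero, zero_mul, zero_add]
  exact sum_Kc_mul_xvalBox s _

/-- A feasible point whose logarithmic coordinates are affine in `k` is the only point at which
`L^□` can be minimal. -/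
lemma eq_of_LBox_le_of_log_affine (hzero : KbarZero Kbar) {y : S → (I → ℕ) → ℝ}
    (hx : x ∈ XDiamond Kbar h ρ) (hy : y ∈ XDiamond Kbar h ρ)
    (hpos : ∀ s, ∀ k ∈ Kbar s, 0 < xvalBox Kbar h x s k) (β : S → ℝ) (ν : I → ℝ)
    (haff : ∀ s, ∀ k ∈ Kbar s,
      Real.log (xvalBox Kbar h x s k * ck k) = β s + ∑ i, (k i : ℝ) * ν i)
    (hle : LBox Kbar h y ≤ LBox Kbar h x) : x = y := by
  have horth : ∑ s, ∑ k ∈ Kbar s, (xvalBox Kbar h y s k - xvalBox Kbar h x s k)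
      * Real.log (xvalBox Kbar h x s k * ck k) = 0 := by
    have hmass : ∀ s, ∑ k ∈ Kbar s, β s * (xvalBox Kbar h y s k - xvalBox Kbar h x s k) = 0 := by
      intro s
      rw [← Finset.mul_sum, Finset.sum_sub_distrib, sum_xvalBox hzero, sum_xvalBox hzero,
        sub_self, mul_zero]
    have htype : ∀ i, ∑ s, ∑ k ∈ Kbar s,
        ν i * ((k i : ℝ) * xvalBox Kbar h y s k - (k i : ℝ) * xvalBox Kbar h x s k) = 0 := by
      intro i
      simp only [← Finset.mul_sum, Finset.sum_sub_distrib, sum_type_mul_xvalBox hzero,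
        hx.2.2 i, hy.2.2 i, sub_self, mul_zero]
    calc _ = ∑ s, ∑ k ∈ Kbar s, (β s * (xvalBox Kbar h y s k - xvalBox Kbar h x s k)
          + ∑ i, ν i * ((k i : ℝ) * xvalBox Kbar h y s k - (k i : ℝ) * xvalBox Kbar h x s k)) := by
          refine Finset.sum_congr rfl fun s _ => Finset.sum_congr rfl fun k hk => ?_
          rw [haff s k hk, mul_add, Finset.mul_sum]
          congr 1
          · ring
          · exact Finset.sum_congr rfl fun i _ => by ring
      _ = ∑ i, ∑ s, ∑ k ∈ Kbar s,
          ν i * ((k i : ℝ) * xvalBox Kbar h y s k - (k i : ℝ) * xvalBox Kbar h x s k) := by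
          simp only [Finset.sum_add_distrib, hmass, zero_add]
          rw [Finset.sum_comm]
          exact Finset.sum_congr rfl fun s _ => Finset.sum_comm
      _ = 0 := Finset.sum_eq_zero fun i _ => htype i
  have hgap := fun s k (hk : k ∈ Kbar s) =>
    entropy_gap_nonneg (xvalBox_nonneg hy.1 s k) (hpos s k hk) (ck_pos k)
  have hsum := Finset.sum_nonneg fun s (_ : s ∈ Finset.univ) =>
    Finset.sum_nonneg fun k hk => (hgap s k hk).1
  have hzero_sum := le_antisymm (by
    simp only [Finset.sum_sub_distrib, horth, ← LBox_eq_sum hzero]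
    linarith) hsum
  have hval : ∀ s, ∀ k ∈ Kbar s, xvalBox Kbar h y s k = xvalBox Kbar h x s k := by
    intro s k hk
    have h1 := (Finset.sum_eq_zero_iff_of_nonneg fun s _ =>
      Finset.sum_nonneg fun k hk => (hgap s k hk).1).1 hzero_sum s (Finset.mem_univ s)
    exact (hgap s k hk).2
      ((Finset.sum_eq_zero_iff_of_nonneg fun k hk => (hgap s k hk).1).1 h1 k hk)
  funext s k
  by_cases hk : k ∈ Kc Kbar s
  · have hk' := Finset.mem_erase.1 hk
    have := hval s k hk'.2
    rw [xvalBox_of_ne_zero s hk'.1, xvalBox_of_ne_zero s hk'.1] at this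
    exact this.symm
  · rw [hx.1.1.2 s k hk, hy.1.1.2 s k hk]

end BoxValues

/-- Lemma 8, second statement: the only equilibrium point of the GRAND-F
fluid dynamics in `X^□` with idle servers of every type is `x^{*,□}`. -/
theorem GRANDF_unique_nonblocking_equilibrium
    (Kbar : S → Finset (I → ℕ))
    (hmono : KbarMono Kbar) (hzero : KbarZero Kbar) (hserve : KbarServe Kbar)
    (ρ : I → ℝ) (hρpos : ∀ i, 0 < ρ i) (hρsum : ∑ i, ρ i = 1)
    (h : S → ℝ) (hhpos : ∀ s, 0 < h s)
    (μ : I → ℝ) (hμpos : ∀ i, 0 < μ i)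
    (hA : AssumptionA Kbar h ρ)
    (xB : S → (I → ℕ) → ℝ) (hxB : xB ∈ XDiamond Kbar h ρ)
    (hminB : ∀ y ∈ XDiamond Kbar h ρ, LBox Kbar h xB ≤ LBox Kbar h y)
    (x : S → (I → ℕ) → ℝ) (hx : x ∈ XBox Kbar h)
    (hpos0 : ∀ s, 0 < x0 Kbar h x s)
    (heq : ∀ s, ∀ k ∈ Kc Kbar s, FdriftBox Kbar h μ ρ x s k = 0) :
    x = xB := by
  exact eq_of_LBox_le_of_log_affine hzero
    ⟨hx, hx.1, sum_type_eq_load hmono hzero hserve hμpos hx hpos0 heq⟩ hxB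
    (xvalBox_pos hmono hzero hserve hρpos hμpos hx hpos0 heq) _ _
    (log_ck_mul_xvalBox hmono hzero hserve hρpos hμpos hx hpos0 heq)
    (hminB x ⟨hx, hx.1, sum_type_eq_load hmono hzero hserve hμpos hx hpos0 heq⟩)
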